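/- arXiv:2605.29304 — 9 statements merged into one kernel-verified Lean document; each statement's English description precedes it below -/
import Mathlib

section
/- The column spaces of A_{I_p}^T and of P A_{I_r}^T intersect only in {0}, and the column space of A^T equals the sum of the column space of A_{I_p}^T and the column space of P A_{I_r}^T; moreover A_{I_p} (A_{I_r} P)^T = 0, i.e., the two blocks are mutually orthogonal. -/
open Matrix

/-- The four Penrose conditions characterizing the Moore–Penrose pseudoinverse. -/
def IsMoorePenrose {k l : Type*} [Fintype k] [Fintype l]
    (A : Matrix k l ℝ) (B : Matrix l k ℝ) : Prop :=
  A * B * A = A ∧ B * A * B = B ∧ (A * B)ᵀ = A * B ∧ (B * A)ᵀ = B * A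

/-- The row space of a matrix is the sum of the row spaces of two complementary row blocks. -/
theorem range_mulVecLin_transpose_eq_sup {m n : Type*} [Fintype m] [DecidableEq m]
    (A : Matrix m n ℝ) (s : Finset m) :
    LinearMap.range (Aᵀ).mulVecLin =
      LinearMap.range ((A.submatrix (Subtype.val : {i // i ∈ s} → m) id)ᵀ).mulVecLin ⊔
        LinearMap.range ((A.submatrix (Subtype.val : {i // i ∈ sᶜ} → m) id)ᵀ).mulVecLin := by
  simp only [Matrix.range_mulVecLin, ← Submodule.span_union]
  congr 1
  ext v
  constructor
  · rintro ⟨i, rfl⟩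
    by_cases hi : i ∈ s
    · exact Or.inl ⟨⟨i, hi⟩, rfl⟩
    · exact Or.inr ⟨⟨i, Finset.mem_compl.2 hi⟩, rfl⟩
  · rintro (⟨i, rfl⟩ | ⟨i, rfl⟩) <;> exact ⟨i, rfl⟩

/-- Subtracting from `N` a matrix with columns in the column space of `M` does not change the sum
of the column spaces of `M` and `N`. -/
theorem range_mulVecLin_sup_sub_mul {k l n : Type*} [Fintype k] [Fintype l]
    (M : Matrix n k ℝ) (N : Matrix n l ℝ) (K : Matrix k l ℝ) :
    LinearMap.range M.mulVecLin ⊔ LinearMap.range (N - M * K).mulVecLin =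
      LinearMap.range M.mulVecLin ⊔ LinearMap.range N.mulVecLin := by
  apply le_antisymm <;> refine sup_le le_sup_left ?_
  · rintro _ ⟨y, rfl⟩
    rw [mulVecLin_apply, sub_mulVec, ← mulVec_mulVec]
    exact sub_mem (Submodule.mem_sup_right ⟨y, rfl⟩) (Submodule.mem_sup_left ⟨K *ᵥ y, rfl⟩)
  · rintro _ ⟨y, rfl⟩
    have h : N.mulVecLin y = M *ᵥ (K *ᵥ y) + (N - M * K) *ᵥ y := by
      rw [mulVecLin_apply, sub_mulVec, ← mulVec_mulVec, add_sub_cancel]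
    rw [h]
    exact add_mem (Submodule.mem_sup_left ⟨K *ᵥ y, rfl⟩) (Submodule.mem_sup_right ⟨y, rfl⟩)

/-- The column spaces of `A_{I_p}ᵀ` and `P A_{I_r}ᵀ` intersect only in `{0}`,
the column space of `Aᵀ` is the sum of those two column spaces, and
`A_{I_p} (A_{I_r} P)ᵀ = 0` (the two blocks are mutually orthogonal). -/
theorem stmt1 {m n : ℕ} (A : Matrix (Fin m) (Fin n) ℝ) (Ip : Finset (Fin m))
    (Ap : Matrix {i // i ∈ Ip} (Fin n) ℝ) (hApdef : Ap = A.submatrix Subtype.val id)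
    (Ar : Matrix {i // i ∈ Ipᶜ} (Fin n) ℝ) (hArdef : Ar = A.submatrix Subtype.val id)
    (Apd : Matrix (Fin n) {i // i ∈ Ip} ℝ) (hApd : IsMoorePenrose Ap Apd)
    (P : Matrix (Fin n) (Fin n) ℝ) (hP : P = 1 - Apd * Ap) :
    (LinearMap.range (Apᵀ).mulVecLin ⊓ LinearMap.range (P * Arᵀ).mulVecLin = ⊥) ∧
      LinearMap.range (Aᵀ).mulVecLin
        = LinearMap.range (Apᵀ).mulVecLin ⊔ LinearMap.range (P * Arᵀ).mulVecLin ∧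
      Ap * (Ar * P)ᵀ = 0 := by
  obtain ⟨hABA, -, -, hBA⟩ := hApd
  have hPt : Pᵀ = P := by rw [hP, transpose_sub, transpose_one, hBA]
  have hAP : Ap * P = 0 := by
    rw [hP, Matrix.mul_sub, Matrix.mul_one, ← Matrix.mul_assoc, hABA, sub_self]
  have hPA : P * Apᵀ = 0 := by rw [← hPt, ← transpose_mul, hAP, transpose_zero]
  have hPP : P * P = P := by
    nth_rewrite 1 [hP]
    rw [Matrix.sub_mul, Matrix.one_mul, Matrix.mul_assoc, hAP, Matrix.mul_zero, sub_zero]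
  refine ⟨?_, ?_, ?_⟩
  · rw [eq_bot_iff]
    rintro v ⟨⟨x, hx⟩, ⟨y, hy⟩⟩
    rw [mulVecLin_apply] at hx hy
    rw [Submodule.mem_bot]
    calc v = P *ᵥ v := by rw [← hy, mulVec_mulVec, ← Matrix.mul_assoc, hPP]
      _ = 0 := by rw [← hx, mulVec_mulVec, hPA, zero_mulVec]
  · have hPAr : P * Arᵀ = Arᵀ - Apᵀ * (Apdᵀ * Arᵀ) := by
      rw [hP, Matrix.sub_mul, Matrix.one_mul, ← hBA, transpose_mul, Matrix.mul_assoc]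
    rw [hPAr, range_mulVecLin_sup_sub_mul, hApdef, hArdef]
    exact range_mulVecLin_transpose_eq_sup A Ip
  · rw [transpose_mul, hPt, ← Matrix.mul_assoc, hAP, Matrix.zero_mul]
end

section
/- Suppose the linear system A x = b is consistent. If x ∈ ℝ^n satisfies A x = b and x ∈ A_{I_p}† b_{I_p} + Range(P A_{I_r}^T) (i.e., x − A_{I_p}† b_{I_p} lies in the column space of P A_{I_r}^T), then x = A† b, the minimum-norm solution. -/
open Matrix

/-- A Moore–Penrose inverse `B` of `A` satisfies `B = Aᵀ Bᵀ B`. -/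
theorem IsMoorePenrose.transpose_mul_transpose_mul {k l : Type*} [Fintype k] [Fintype l]
    {A : Matrix k l ℝ} {B : Matrix l k ℝ} (h : IsMoorePenrose A B) : Aᵀ * Bᵀ * B = B := by
  rw [← transpose_mul, h.2.2.2, h.2.1]

/-- The projector `B A` onto the row space of `A` fixes the transpose of every submatrix of rows
of `A`. -/
theorem IsMoorePenrose.mul_mul_submatrix_transpose {k l j : Type*} [Fintype k] [Fintype l]
    {A : Matrix k l ℝ} {B : Matrix l k ℝ} (h : IsMoorePenrose A B) (f : j → k) :
    B * A * (A.submatrix f id)ᵀ = (A.submatrix f id)ᵀ := by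
  have hrow : A.submatrix f id * (B * A) = A.submatrix f id := by
    have := congrArg (fun M => M.submatrix f id) h.1
    rwa [Matrix.mul_assoc] at this
  rw [← h.2.2.2, ← transpose_mul, hrow]

/-- If `x` satisfies `A x = b` (so the system is consistent) and
`x − A_{I_p}† b_{I_p}` lies in the column space of `P A_{I_r}ᵀ`, then `x = A† b`,
the minimum-norm solution. -/
theorem stmt7 {m n : ℕ} (A : Matrix (Fin m) (Fin n) ℝ) (b : Fin m → ℝ) (Ip : Finset (Fin m))
    (Ap : Matrix {i // i ∈ Ip} (Fin n) ℝ) (hApdef : Ap = A.submatrix Subtype.val id)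
    (Ar : Matrix {i // i ∈ Ipᶜ} (Fin n) ℝ) (hArdef : Ar = A.submatrix Subtype.val id)
    (Ad : Matrix (Fin n) (Fin m) ℝ) (hAd : IsMoorePenrose A Ad)
    (Apd : Matrix (Fin n) {i // i ∈ Ip} ℝ) (hApd : IsMoorePenrose Ap Apd)
    (P : Matrix (Fin n) (Fin n) ℝ) (hP : P = 1 - Apd * Ap)
    (bp : {i // i ∈ Ip} → ℝ) (hbp : bp = fun i => b i.1)
    (x : Fin n → ℝ) (hx : A.mulVec x = b)
    (hrange : ∃ y : {i // i ∈ Ipᶜ} → ℝ, x - Apd.mulVec bp = (P * Arᵀ).mulVec y) :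
    x = Ad.mulVec b := by
  obtain ⟨y, hy⟩ := hrange
  have hAr : Ad * A * Arᵀ = Arᵀ := hArdef ▸ hAd.mul_mul_submatrix_transpose _
  have hAp : Ad * A * Apᵀ = Apᵀ := hApdef ▸ hAd.mul_mul_submatrix_transpose _
  have hApd' : Ad * A * Apd = Apd := by
    rw [← hApd.transpose_mul_transpose_mul, ← Matrix.mul_assoc, ← Matrix.mul_assoc, hAp]
  have hPAr : Ad * A * (P * Arᵀ) = P * Arᵀ := by
    rw [hP, Matrix.sub_mul, Matrix.one_mul, Matrix.mul_sub, hAr, Matrix.mul_assoc Apd,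
      ← Matrix.mul_assoc (Ad * A), hApd']
  have hxy : x = (P * Arᵀ).mulVec y + Apd.mulVec bp := sub_eq_iff_eq_add.mp hy
  have hfix : (Ad * A).mulVec x = x := by
    rw [hxy, mulVec_add, mulVec_mulVec, mulVec_mulVec, hPAr, hApd']
  rw [← hx, mulVec_mulVec, hfix]
end

section
/- Suppose A x = b is consistent and x ∈ ℝ^n satisfies A_{I_p} x = b_{I_p}. Write r := A_{I_r} x − b_{I_r}. Then for any matrix S ∈ ℝ^{m_r×q}, the inner product ⟨x − A† b, P A_{I_r}^T S S^T r⟩ equals ‖S^T r‖₂². -/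
open Matrix

/-- Suppose `A x = b` is consistent and `A_{I_p} x = b_{I_p}`.
With `r := A_{I_r} x − b_{I_r}`, for any matrix `S ∈ ℝ^{m_r×q}` one has
`⟨x − A† b, P A_{I_r}ᵀ S Sᵀ r⟩ = ‖Sᵀ r‖₂²`. -/
theorem stmt8 {m n q : ℕ} (A : Matrix (Fin m) (Fin n) ℝ) (b : Fin m → ℝ) (Ip : Finset (Fin m))
    (Ap : Matrix {i // i ∈ Ip} (Fin n) ℝ) (hApdef : Ap = A.submatrix Subtype.val id)
    (Ar : Matrix {i // i ∈ Ipᶜ} (Fin n) ℝ) (hArdef : Ar = A.submatrix Subtype.val id)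
    (Ad : Matrix (Fin n) (Fin m) ℝ) (hAd : IsMoorePenrose A Ad)
    (Apd : Matrix (Fin n) {i // i ∈ Ip} ℝ) (hApd : IsMoorePenrose Ap Apd)
    (P : Matrix (Fin n) (Fin n) ℝ) (hP : P = 1 - Apd * Ap)
    (bp : {i // i ∈ Ip} → ℝ) (hbp : bp = fun i => b i.1)
    (br : {i // i ∈ Ipᶜ} → ℝ) (hbr : br = fun i => b i.1)
    (hcons : ∃ xs : Fin n → ℝ, A.mulVec xs = b)
    (x : Fin n → ℝ) (hx : Ap.mulVec x = bp)
    (r : {i // i ∈ Ipᶜ} → ℝ) (hr : r = Ar.mulVec x - br)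
    (S : Matrix {i // i ∈ Ipᶜ} (Fin q) ℝ) :
    (x - Ad.mulVec b) ⬝ᵥ (P * Arᵀ * S).mulVec (Sᵀ.mulVec r)
      = (Sᵀ.mulVec r) ⬝ᵥ (Sᵀ.mulVec r) := by
  subst hP hr
  obtain ⟨xs, hxs⟩ := hcons
  have hA : A.mulVec (Ad.mulVec b) = b := by
    rw [← hxs, mulVec_mulVec, mulVec_mulVec, hAd.1]
  have hAp : Ap.mulVec (x - Ad.mulVec b) = 0 := by
    rw [mulVec_sub, hx, hbp, hApdef]
    funext i
    exact sub_eq_zero.mpr (congrFun hA i.1).symm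
  have hAr : Ar.mulVec (x - Ad.mulVec b) = Ar.mulVec x - br := by
    rw [mulVec_sub, hbr, hArdef]
    congr 1
    funext i
    exact congrFun hA i.1
  rw [dotProduct_mulVec, ← mulVec_transpose, transpose_mul, transpose_mul, transpose_transpose,
    transpose_sub, transpose_one, hApd.2.2.2, ← mulVec_mulVec, ← mulVec_mulVec, sub_mulVec,
    one_mulVec, ← mulVec_mulVec, hAp, mulVec_zero, sub_zero, hAr]
end

section
/- Suppose A x = b is consistent, ζ ∈ (0,2), and x ∈ ℝ^n satisfies A_{I_p} x = b_{I_p}. Write r := A_{I_r} x − b_{I_r} and let S ∈ ℝ^{m_r×q} satisfy S^T r ≠ 0. Define the stepsize α := (2−ζ) ‖S^T r‖₂² / ‖P A_{I_r}^T S S^T r‖₂² and the update x⁺ := x − α P A_{I_r}^T S S^T r. Then ‖x⁺ − A† b‖₂² ≤ ‖x − A† b‖₂² − ζ(2−ζ) ‖S^T r‖₂² / ‖S^T A_{I_r} P‖₂². -/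
open Matrix

/-- The spectral norm of a real matrix: the supremum of `‖A v‖₂` over Euclidean unit
vectors `v`, written via squared Euclidean norms. -/
noncomputable def spec {k l : Type*} [Fintype k] [Fintype l] (A : Matrix k l ℝ) : ℝ :=
  Real.sqrt (sSup {t : ℝ | ∃ v : l → ℝ, v ⬝ᵥ v = 1 ∧ t = A.mulVec v ⬝ᵥ A.mulVec v})

theorem dotProduct_sq_le {k : Type*} [Fintype k] (a b : k → ℝ) :
    (a ⬝ᵥ b) ^ 2 ≤ (a ⬝ᵥ a) * (b ⬝ᵥ b) := by
  simpa [dotProduct, sq] using Finset.sum_mul_sq_le_sq_mul_sq Finset.univ a b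

theorem dotProduct_self_nonneg_real {k : Type*} [Fintype k] (a : k → ℝ) : 0 ≤ a ⬝ᵥ a :=
  Finset.sum_nonneg fun i _ => mul_self_nonneg (a i)

theorem bddAbove_spec_set {k l : Type*} [Fintype k] [Fintype l] (A : Matrix k l ℝ) :
    BddAbove {t : ℝ | ∃ v : l → ℝ, v ⬝ᵥ v = 1 ∧ t = A.mulVec v ⬝ᵥ A.mulVec v} := by
  refine ⟨∑ i, A i ⬝ᵥ A i, ?_⟩
  rintro t ⟨v, hv, rfl⟩
  refine Finset.sum_le_sum fun i _ => ?_
  have h := dotProduct_sq_le (A i) v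
  rw [hv, mul_one, sq] at h
  exact h

theorem spec_sq {k l : Type*} [Fintype k] [Fintype l] (A : Matrix k l ℝ) :
    spec A ^ 2 = sSup {t : ℝ | ∃ v : l → ℝ, v ⬝ᵥ v = 1 ∧ t = A.mulVec v ⬝ᵥ A.mulVec v} := by
  refine Real.sq_sqrt (Real.sSup_nonneg ?_)
  rintro t ⟨v, -, rfl⟩
  exact dotProduct_self_nonneg_real _

theorem mulVec_dotProduct_self_le {k l : Type*} [Fintype k] [Fintype l] (A : Matrix k l ℝ)
    (v : l → ℝ) (hv : 0 < v ⬝ᵥ v) :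
    A.mulVec v ⬝ᵥ A.mulVec v ≤ spec A ^ 2 * (v ⬝ᵥ v) := by
  have hs : √(v ⬝ᵥ v) * √(v ⬝ᵥ v) = v ⬝ᵥ v := Real.mul_self_sqrt hv.le
  have hinv : (√(v ⬝ᵥ v))⁻¹ * (√(v ⬝ᵥ v))⁻¹ = (v ⬝ᵥ v)⁻¹ := by rw [← mul_inv, hs]
  have h := le_csSup (bddAbove_spec_set A) ⟨(√(v ⬝ᵥ v))⁻¹ • v, by
    rw [smul_dotProduct, dotProduct_smul, smul_eq_mul, smul_eq_mul, ← mul_assoc, hinv,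
      inv_mul_cancel₀ hv.ne'], rfl⟩
  rw [← spec_sq, mulVec_smul, smul_dotProduct, dotProduct_smul, smul_eq_mul, smul_eq_mul,
    ← mul_assoc, hinv, inv_mul_eq_div, div_le_iff₀ hv] at h
  exact h

/-- The transpose of a matrix obeys the same norm bound as the matrix. -/
theorem transpose_mulVec_dotProduct_self_le {k l : Type*} [Fintype k] [Fintype l]
    (A : Matrix k l ℝ) (w : k → ℝ) (hw : 0 < Aᵀ.mulVec w ⬝ᵥ Aᵀ.mulVec w) :
    Aᵀ.mulVec w ⬝ᵥ Aᵀ.mulVec w ≤ spec A ^ 2 * (w ⬝ᵥ w) := by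
  set u := Aᵀ.mulVec w with hu
  have h1 : u ⬝ᵥ u = A.mulVec u ⬝ᵥ w := by
    nth_rw 2 [hu]
    rw [mulVec_transpose, dotProduct_comm, ← dotProduct_mulVec, dotProduct_comm]
  have h2 := dotProduct_sq_le (A.mulVec u) w
  rw [← h1] at h2
  have h3 := mul_le_mul_of_nonneg_right (mulVec_dotProduct_self_le A u hw)
    (dotProduct_self_nonneg_real w)
  refine le_of_mul_le_mul_right ?_ hw
  nlinarith

/-- One-step decrease of the subspace-constrained randomized iteration:
with `r := A_{I_r} x − b_{I_r}`, `Sᵀ r ≠ 0`,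
`α := (2−ζ)‖Sᵀ r‖₂²/‖P A_{I_r}ᵀ S Sᵀ r‖₂²` and `x⁺ := x − α P A_{I_r}ᵀ S Sᵀ r`, one has
`‖x⁺ − A† b‖₂² ≤ ‖x − A† b‖₂² − ζ(2−ζ)‖Sᵀ r‖₂²/‖Sᵀ A_{I_r} P‖₂²`. -/
theorem stmt9 {m n q : ℕ} (A : Matrix (Fin m) (Fin n) ℝ) (b : Fin m → ℝ) (Ip : Finset (Fin m))
    (ζ : ℝ) (hζ0 : 0 < ζ) (hζ2 : ζ < 2)
    (Ap : Matrix {i // i ∈ Ip} (Fin n) ℝ) (hApdef : Ap = A.submatrix Subtype.val id)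
    (Ar : Matrix {i // i ∈ Ipᶜ} (Fin n) ℝ) (hArdef : Ar = A.submatrix Subtype.val id)
    (Ad : Matrix (Fin n) (Fin m) ℝ) (hAd : IsMoorePenrose A Ad)
    (Apd : Matrix (Fin n) {i // i ∈ Ip} ℝ) (hApd : IsMoorePenrose Ap Apd)
    (P : Matrix (Fin n) (Fin n) ℝ) (hP : P = 1 - Apd * Ap)
    (bp : {i // i ∈ Ip} → ℝ) (hbp : bp = fun i => b i.1)
    (br : {i // i ∈ Ipᶜ} → ℝ) (hbr : br = fun i => b i.1)
    (hcons : ∃ xs : Fin n → ℝ, A.mulVec xs = b)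
    (x : Fin n → ℝ) (hx : Ap.mulVec x = bp)
    (r : {i // i ∈ Ipᶜ} → ℝ) (hr : r = Ar.mulVec x - br)
    (S : Matrix {i // i ∈ Ipᶜ} (Fin q) ℝ) (hS : Sᵀ.mulVec r ≠ 0)
    (α : ℝ)
    (hα : α = (2 - ζ) * (Sᵀ.mulVec r ⬝ᵥ Sᵀ.mulVec r)
        / ((P * Arᵀ * S).mulVec (Sᵀ.mulVec r) ⬝ᵥ (P * Arᵀ * S).mulVec (Sᵀ.mulVec r)))
    (xplus : Fin n → ℝ) (hxplus : xplus = x - α • (P * Arᵀ * S).mulVec (Sᵀ.mulVec r)) :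
    (xplus - Ad.mulVec b) ⬝ᵥ (xplus - Ad.mulVec b)
      ≤ (x - Ad.mulVec b) ⬝ᵥ (x - Ad.mulVec b)
        - ζ * (2 - ζ) * (Sᵀ.mulVec r ⬝ᵥ Sᵀ.mulVec r) / spec (Sᵀ * (Ar * P)) ^ 2 := by
  have hAb : A.mulVec (Ad.mulVec b) = b := by
    obtain ⟨xs, rfl⟩ := hcons
    rw [mulVec_mulVec, mulVec_mulVec, hAd.1]
  have hAp : Ap.mulVec (Ad.mulVec b) = bp := by
    funext i
    rw [hApdef, hbp]
    exact congrFun hAb i.1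
  have hAr : Ar.mulVec (Ad.mulVec b) = br := by
    funext i
    rw [hArdef, hbr]
    exact congrFun hAb i.1
  have hPT : Pᵀ = P := by
    rw [hP, transpose_sub, transpose_one, hApd.2.2.2]
  have hT : P * Arᵀ * S = (Sᵀ * (Ar * P))ᵀ := by
    rw [transpose_mul, transpose_mul, transpose_transpose, hPT]
  rw [hT] at hα hxplus
  set e := x - Ad.mulVec b with he
  have hPe : P.mulVec e = e := by
    rw [hP, sub_mulVec, one_mulVec, ← mulVec_mulVec, he, mulVec_sub Ap, hx, hAp, sub_self,
      mulVec_zero, sub_zero]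
  have hw : (Sᵀ * (Ar * P)).mulVec e = Sᵀ.mulVec r := by
    rw [← mulVec_mulVec, ← mulVec_mulVec, hPe, hr, he, mulVec_sub Ar, hAr]
  set M := Sᵀ * (Ar * P)
  set w := Sᵀ.mulVec r
  have heu : e ⬝ᵥ Mᵀ.mulVec w = w ⬝ᵥ w := by
    rw [mulVec_transpose, dotProduct_comm, ← dotProduct_mulVec, hw]
  have hW : 0 < w ⬝ᵥ w :=
    lt_of_le_of_ne (dotProduct_self_nonneg_real w) fun h => hS (dotProduct_self_eq_zero.1 h.symm)
  have hU : 0 < Mᵀ.mulVec w ⬝ᵥ Mᵀ.mulVec w := by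
    refine lt_of_le_of_ne (dotProduct_self_nonneg_real _) fun h => hW.ne' ?_
    rw [← heu, dotProduct_self_eq_zero.1 h.symm, dotProduct_zero]
  have hUW := transpose_mulVec_dotProduct_self_le M w hU
  have hs : 0 < spec M ^ 2 := pos_of_mul_pos_left (hU.trans_le hUW) hW.le
  have hsub : xplus - Ad.mulVec b = e - α • Mᵀ.mulVec w := by
    rw [hxplus, he]; abel
  have hexp : (xplus - Ad.mulVec b) ⬝ᵥ (xplus - Ad.mulVec b)
      = e ⬝ᵥ e - 2 * α * (w ⬝ᵥ w) + α ^ 2 * (Mᵀ.mulVec w ⬝ᵥ Mᵀ.mulVec w) := by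
    rw [hsub]
    simp only [sub_dotProduct, dotProduct_sub, smul_dotProduct, dotProduct_smul, smul_eq_mul,
      dotProduct_comm (Mᵀ.mulVec w) e, heu]
    ring
  rw [hexp, hα]
  generalize Mᵀ.mulVec w ⬝ᵥ Mᵀ.mulVec w = U at *
  generalize w ⬝ᵥ w = W at *
  generalize spec M ^ 2 = s at *
  have hkey : W / s ≤ W ^ 2 / U := by
    rw [div_le_div_iff₀ hs hU]
    nlinarith
  have hstep : e ⬝ᵥ e - 2 * ((2 - ζ) * W / U) * W + ((2 - ζ) * W / U) ^ 2 * U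
      = e ⬝ᵥ e - ζ * (2 - ζ) * (W ^ 2 / U) := by
    field_simp
    ring
  rw [hstep, mul_div_assoc]
  have hζ : 0 ≤ ζ * (2 - ζ) := mul_nonneg hζ0.le (by linarith)
  linarith [mul_le_mul_of_nonneg_left hkey hζ]
end

section
/- The Frobenius norm of A_{I_r} P equals the Frobenius norm of A − A A_{I_p}† A_{I_p}; that is, ‖A_{I_r} P‖_F² = ‖A − A A_{I_p}† A_{I_p}‖_F², so minimizing the interpolative-decomposition error ‖A − A A_{I_p}† A_{I_p}‖_F over choices of I_p is equivalent to minimizing ‖A_{I_r} P‖_F. -/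
open Matrix

/-- The Frobenius norm of a real matrix. -/
noncomputable def frobNorm {k l : Type*} [Fintype k] [Fintype l] (A : Matrix k l ℝ) : ℝ :=
  Real.sqrt (∑ i, ∑ j, A i j ^ 2)

/-- Deleting rows outside `s` that vanish does not change the Frobenius norm. -/
lemma frobNorm_submatrix_of_rows_eq_zero {k l : Type*} [Fintype k] [Fintype l]
    (M : Matrix k l ℝ) (s : Finset k) (h : ∀ i ∉ s, ∀ j, M i j = 0) :
    frobNorm (M.submatrix (Subtype.val : {i // i ∈ s} → k) id) = frobNorm M := by
  unfold frobNorm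
  congr 1
  simp only [submatrix_apply, id_eq]
  rw [Finset.sum_coe_sort s (fun i => ∑ j, M i j ^ 2)]
  refine Finset.sum_subset (Finset.subset_univ s) fun i _ hi => ?_
  exact Finset.sum_eq_zero fun j _ => by rw [h i hi j]; norm_num

/-- `‖A_{I_r} P‖_F = ‖A − A A_{I_p}† A_{I_p}‖_F`, in particular
`‖A_{I_r} P‖_F² = ‖A − A A_{I_p}† A_{I_p}‖_F²` (so minimizing the interpolative
decomposition error over `I_p` is equivalent to minimizing `‖A_{I_r} P‖_F`). -/
theorem stmt14 {m n : ℕ} (A : Matrix (Fin m) (Fin n) ℝ) (Ip : Finset (Fin m))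
    (Ap : Matrix {i // i ∈ Ip} (Fin n) ℝ) (hApdef : Ap = A.submatrix Subtype.val id)
    (Ar : Matrix {i // i ∈ Ipᶜ} (Fin n) ℝ) (hArdef : Ar = A.submatrix Subtype.val id)
    (Apd : Matrix (Fin n) {i // i ∈ Ip} ℝ) (hApd : IsMoorePenrose Ap Apd)
    (P : Matrix (Fin n) (Fin n) ℝ) (hP : P = 1 - Apd * Ap) :
    frobNorm (Ar * P) = frobNorm (A - A * Apd * Ap) ∧
      frobNorm (Ar * P) ^ 2 = frobNorm (A - A * Apd * Ap) ^ 2 := by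
  have hM : A - A * Apd * Ap = A * P := by
    rw [hP, Matrix.mul_sub, Matrix.mul_one, Matrix.mul_assoc]
  have hAp : Ap * P = 0 := by
    rw [hP, Matrix.mul_sub, Matrix.mul_one, ← Matrix.mul_assoc, hApd.1, sub_self]
  have key : frobNorm (Ar * P) = frobNorm (A - A * Apd * Ap) := by
    rw [hM, ← frobNorm_submatrix_of_rows_eq_zero (A * P) Ipᶜ, hArdef]
    · rfl
    · intro i hi j
      have hi' : i ∈ Ip := by simpa using hi
      have hrow := congrFun (congrFun hAp ⟨i, hi'⟩) j
      rw [hApdef] at hrow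
      exact hrow
  exact ⟨key, by rw [key]⟩
end

section
/- Let ℓ ≥ 2 be an integer and set j_{k,ℓ} := max{k − ℓ + 1, 0}. Let {d^k}_{k≥0} ⊂ ℝ^n be given and define {p^k}_{k≥0} by the truncated Gram–Schmidt recursion p^0 = d^0 and p^k = d^k − Σ_{i=j_{k,ℓ}}^{k−1} (⟨d^k, p^i⟩ / ‖p^i‖₂²) p^i for k ≥ 1. If k ≥ 1 and p^i ≠ 0 for i = 0, 1, …, k, then ⟨p^μ, p^ν⟩ = 0 for all j_{k,ℓ} ≤ μ < ν ≤ k. -/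
open Matrix

/-- Subtracting from `v` its projections onto finitely many pairwise orthogonal vectors `p i`
leaves a vector orthogonal to each nonzero `p m`. -/
theorem dotProduct_sub_sum_proj_eq_zero {ι κ : Type*} [Fintype κ] {s : Finset ι}
    {p : ι → κ → ℝ} (v : κ → ℝ) {m : ι} (hm : m ∈ s) (hpm : p m ≠ 0)
    (horth : ∀ i ∈ s, i ≠ m → p m ⬝ᵥ p i = 0) :
    p m ⬝ᵥ (v - ∑ i ∈ s, ((v ⬝ᵥ p i) / (p i ⬝ᵥ p i)) • p i) = 0 := by
  have hne : p m ⬝ᵥ p m ≠ 0 := dotProduct_self_eq_zero.not.mpr hpm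
  rw [dotProduct_sub, dotProduct_sum, Finset.sum_eq_single_of_mem m hm]
  · rw [dotProduct_smul, smul_eq_mul, div_mul_cancel₀ _ hne, dotProduct_comm, sub_self]
  · intro i hi him
    rw [dotProduct_smul, horth i hi him, smul_zero]

/-- Each vector produced by the truncated Gram–Schmidt recursion is orthogonal to all the vectors
in its own truncation window. -/
theorem truncatedGramSchmidt_orthogonal {κ : Type*} [Fintype κ] {ℓ k : ℕ} {d p : ℕ → κ → ℝ}
    (hrec : ∀ k, 1 ≤ k →
      p k = d k - ∑ i ∈ Finset.Ico (k + 1 - ℓ) k, ((d k ⬝ᵥ p i) / (p i ⬝ᵥ p i)) • p i)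
    (hnz : ∀ i, i ≤ k → p i ≠ 0) (ν : ℕ) (hν : ν ≤ k) :
    ∀ μ, ν + 1 - ℓ ≤ μ → μ < ν → p μ ⬝ᵥ p ν = 0 := by
  induction ν using Nat.strong_induction_on with
  | _ ν ih =>
    intro μ hμ hμν
    rw [hrec ν (by omega)]
    refine dotProduct_sub_sum_proj_eq_zero _ (Finset.mem_Ico.mpr ⟨hμ, hμν⟩)
      (hnz μ (by omega)) fun i hi hiμ ↦ ?_
    rw [Finset.mem_Ico] at hi
    rcases lt_or_gt_of_ne hiμ with h | h
    · rw [dotProduct_comm]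
      exact ih μ hμν (by omega) i (by omega) h
    · exact ih i hi.2 (by omega) μ (by omega) h

/-- Truncated Gram–Schmidt: let `ℓ ≥ 2`, `j_{k,ℓ} = max (k−ℓ+1) 0`
(written `k + 1 - ℓ` in `ℕ`), `p 0 = d 0` and
`p k = d k − Σ_{i=j_{k,ℓ}}^{k−1} (⟨d k, p i⟩/‖p i‖₂²) p i` for `k ≥ 1`.
If `k ≥ 1` and `p i ≠ 0` for all `i ≤ k`, then `⟨p μ, p ν⟩ = 0` for all
`j_{k,ℓ} ≤ μ < ν ≤ k`. -/
theorem stmt15 {n : ℕ} (ℓ : ℕ) (hℓ : 2 ≤ ℓ) (d p : ℕ → Fin n → ℝ)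
    (hp0 : p 0 = d 0)
    (hrec : ∀ k, 1 ≤ k →
      p k = d k - ∑ i ∈ Finset.Ico (k + 1 - ℓ) k, ((d k ⬝ᵥ p i) / (p i ⬝ᵥ p i)) • p i)
    (k : ℕ) (hk : 1 ≤ k) (hnz : ∀ i, i ≤ k → p i ≠ 0) :
    ∀ μ ν, k + 1 - ℓ ≤ μ → μ < ν → ν ≤ k → p μ ⬝ᵥ p ν = 0 := by
  intro μ ν hμ hμν hνk
  exact truncatedGramSchmidt_orthogonal hrec hnz ν hνk μ (by omega) hμν
end

section
/- Suppose A x = b is consistent. Let ℓ ≥ 1 be an integer, j_{k,ℓ} := max{k − ℓ + 1, 0}, and let S_0, S_1, … ∈ ℝ^{m_r×q} be given sketching matrices. Define x^0 := A_{I_p}† b_{I_p}, d^k := −P A_{I_r}^T S_k S_k^T (A_{I_r} x^k − b_{I_r}), p^0 := d^0, p^k := d^k − Σ_{i=j_{k,ℓ}}^{k−1} (⟨d^k, p^i⟩/‖p^i‖₂²) p^i for k ≥ 1 (whenever the divisors are nonzero), and x^{k+1} := the minimizer of ‖x − A† b‖₂² over x ∈ x^k + span{p^k}. Then: (i) A_{I_p}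 x^k = b_{I_p} for all k ≥ 0; (ii) if S_i^T (A_{I_r} x^i − b_{I_r}) ≠ 0 for all i = 0, …, k, then p^k ≠ 0 and ⟨p^k, x^k − A† b⟩ = −‖S_k^T (A_{I_r} x^k − b_{I_r})‖₂²; and (iii) if additionally ℓ ≥ 2 and k ≥ 1, then ⟨p^μ, p^ν⟩ = 0 for all j_{k,ℓ} ≤ μ < ν ≤ k. -/
open Matrix

theorem dotProduct_eq_zero_of_forall_le {n : ℕ} (e p : Fin n → ℝ)
    (h : ∀ u : ℝ, e ⬝ᵥ e ≤ (e + u • p) ⬝ᵥ (e + u • p)) : p ⬝ᵥ e = 0 := by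
  have hexp : ∀ u : ℝ, 0 ≤ 2 * u * (p ⬝ᵥ e) + u ^ 2 * (p ⬝ᵥ p) := fun u => by
    have hu := h u
    simp only [add_dotProduct, dotProduct_add, smul_dotProduct, dotProduct_smul, smul_eq_mul,
      dotProduct_comm e p] at hu
    linarith
  have hpp : 0 ≤ p ⬝ᵥ p := by
    simpa using dotProduct_star_self_nonneg p
  have hpos : 0 < p ⬝ᵥ p + 1 := by linarith
  have hu := hexp (-(p ⬝ᵥ e) / (p ⬝ᵥ p + 1))
  have hfrac : 2 * (-(p ⬝ᵥ e) / (p ⬝ᵥ p + 1)) * (p ⬝ᵥ e)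
      + (-(p ⬝ᵥ e) / (p ⬝ᵥ p + 1)) ^ 2 * (p ⬝ᵥ p)
      = -((p ⬝ᵥ e) ^ 2 * (p ⬝ᵥ p + 2)) / (p ⬝ᵥ p + 1) ^ 2 := by
    field_simp
    ring
  rw [hfrac, le_div_iff₀ (by positivity)] at hu
  nlinarith [sq_nonneg (p ⬝ᵥ e), mul_nonneg (sq_nonneg (p ⬝ᵥ e)) hpp]

/-- Truncated Gram–Schmidt produces directions that are orthogonal within each window. -/
theorem truncated_gramSchmidt_orthogonal {n : ℕ} (ℓ : ℕ) (p d : ℕ → Fin n → ℝ)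
    (hrec : ∀ k, 1 ≤ k →
      p k = d k - ∑ i ∈ Finset.Ico (k + 1 - ℓ) k, ((d k ⬝ᵥ p i) / (p i ⬝ᵥ p i)) • p i) :
    ∀ ν μ, ν + 1 - ℓ ≤ μ → μ < ν → p μ ⬝ᵥ p ν = 0 := by
  intro ν
  induction ν using Nat.strong_induction_on with
  | _ ν ih =>
    intro μ hμ hμν
    rw [hrec ν (by omega), dotProduct_sub, dotProduct_sum,
      Finset.sum_eq_single_of_mem μ (Finset.mem_Ico.2 ⟨hμ, hμν⟩)]
    · by_cases h0 : p μ = 0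
      · simp [h0]
      · have hne : p μ ⬝ᵥ p μ ≠ 0 := fun h => h0 (dotProduct_self_eq_zero.1 h)
        rw [dotProduct_smul, smul_eq_mul, div_mul_cancel₀ _ hne, dotProduct_comm, sub_self]
    · intro i hi hiμ
      rw [Finset.mem_Ico] at hi
      rw [dotProduct_smul]
      rcases lt_or_gt_of_ne hiμ with h | h
      · rw [dotProduct_comm (p μ), ih μ hμν i (by omega) h, smul_zero]
      · rw [ih i hi.2 μ (by omega) h, smul_zero]

/-- For the subspace-constrained iteration with truncated Gram–Schmidt
directions: (i) every iterate satisfies `A_{I_p} x^k = b_{I_p}`; (ii) if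
`S_iᵀ(A_{I_r} x^i − b_{I_r}) ≠ 0` for `i = 0,…,k` then `p^k ≠ 0` and
`⟨p^k, x^k − A†b⟩ = −‖S_kᵀ(A_{I_r} x^k − b_{I_r})‖₂²`; (iii) if moreover `ℓ ≥ 2` and
`k ≥ 1`, then `⟨p^μ, p^ν⟩ = 0` for all `j_{k,ℓ} ≤ μ < ν ≤ k`. -/
theorem stmt16 {m n q : ℕ} (A : Matrix (Fin m) (Fin n) ℝ) (b : Fin m → ℝ) (Ip : Finset (Fin m))
    (ℓ : ℕ) (hℓ : 1 ≤ ℓ)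
    (Ap : Matrix {i // i ∈ Ip} (Fin n) ℝ) (hApdef : Ap = A.submatrix Subtype.val id)
    (Ar : Matrix {i // i ∈ Ipᶜ} (Fin n) ℝ) (hArdef : Ar = A.submatrix Subtype.val id)
    (Ad : Matrix (Fin n) (Fin m) ℝ) (hAd : IsMoorePenrose A Ad)
    (Apd : Matrix (Fin n) {i // i ∈ Ip} ℝ) (hApd : IsMoorePenrose Ap Apd)
    (P : Matrix (Fin n) (Fin n) ℝ) (hP : P = 1 - Apd * Ap)
    (bp : {i // i ∈ Ip} → ℝ) (hbp : bp = fun i => b i.1)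
    (br : {i // i ∈ Ipᶜ} → ℝ) (hbr : br = fun i => b i.1)
    (hcons : ∃ xs : Fin n → ℝ, A.mulVec xs = b)
    (S : ℕ → Matrix {i // i ∈ Ipᶜ} (Fin q) ℝ)
    (x p d : ℕ → Fin n → ℝ)
    (hx0 : x 0 = Apd.mulVec bp)
    (hd : ∀ k, d k = -((P * Arᵀ * S k).mulVec ((S k)ᵀ.mulVec (Ar.mulVec (x k) - br))))
    (hp0 : p 0 = d 0)
    (hrec : ∀ k, 1 ≤ k →
      p k = d k - ∑ i ∈ Finset.Ico (k + 1 - ℓ) k, ((d k ⬝ᵥ p i) / (p i ⬝ᵥ p i)) • p i)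
    (hmin : ∀ k, (∃ t : ℝ, x (k + 1) = x k + t • p k) ∧
      ∀ t : ℝ, (x (k + 1) - Ad.mulVec b) ⬝ᵥ (x (k + 1) - Ad.mulVec b)
        ≤ (x k + t • p k - Ad.mulVec b) ⬝ᵥ (x k + t • p k - Ad.mulVec b)) :
    (∀ k, Ap.mulVec (x k) = bp) ∧
      (∀ k, (∀ i, i ≤ k → (S i)ᵀ.mulVec (Ar.mulVec (x i) - br) ≠ 0) →
        p k ≠ 0 ∧
          p k ⬝ᵥ (x k - Ad.mulVec b)
            = -((S k)ᵀ.mulVec (Ar.mulVec (x k) - br)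
                ⬝ᵥ (S k)ᵀ.mulVec (Ar.mulVec (x k) - br))) ∧
      (∀ k, 2 ≤ ℓ → 1 ≤ k →
        (∀ i, i ≤ k → (S i)ᵀ.mulVec (Ar.mulVec (x i) - br) ≠ 0) →
        ∀ μ ν, k + 1 - ℓ ≤ μ → μ < ν → ν ≤ k → p μ ⬝ᵥ p ν = 0) := by
  have hy : A.mulVec (Ad.mulVec b) = b := by
    obtain ⟨xs, rfl⟩ := hcons
    rw [mulVec_mulVec, mulVec_mulVec, hAd.1]
  generalize Ad.mulVec b = y at hy hmin ⊢
  have hApy : Ap.mulVec y = bp := by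
    subst hApdef hbp
    funext i
    exact congrFun hy i.1
  have hAry : Ar.mulVec y = br := by
    subst hArdef hbr
    funext i
    exact congrFun hy i.1
  have hApP : Ap * P = 0 := by
    rw [hP, Matrix.mul_sub, Matrix.mul_one, ← Matrix.mul_assoc, hApd.1, sub_self]
  have hPsymm : Pᵀ = P := by
    rw [hP, transpose_sub, transpose_one, hApd.2.2.2]
  have hApd_zero : ∀ k, Ap.mulVec (d k) = 0 := fun k => by
    rw [hd, mulVec_neg, mulVec_mulVec, ← Matrix.mul_assoc, ← Matrix.mul_assoc, hApP]
    simp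
  have hApp_zero : ∀ k, Ap.mulVec (p k) = 0 := fun k => by
    induction k using Nat.strong_induction_on with
    | _ k ih =>
      rcases Nat.eq_zero_or_pos k with rfl | hk
      · rw [hp0, hApd_zero]
      · rw [hrec k hk, mulVec_sub, hApd_zero, zero_sub, neg_eq_zero, mulVec_sum]
        refine Finset.sum_eq_zero fun i hi => ?_
        rw [mulVec_smul, ih i (Finset.mem_Ico.1 hi).2, smul_zero]
  have hfeas : ∀ k, Ap.mulVec (x k) = bp := fun k => by
    induction k with
    | zero => rw [hx0, ← hApy, mulVec_mulVec, mulVec_mulVec, hApd.1]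
    | succ k ih =>
      obtain ⟨t, ht⟩ := (hmin k).1
      rw [ht, mulVec_add, mulVec_smul, hApp_zero, smul_zero, add_zero, ih]
  have hres : ∀ k, Ar.mulVec (x k) - br = Ar.mulVec (x k - y) := fun k => by
    rw [mulVec_sub, hAry]
  have hPe : ∀ k, P.mulVec (x k - y) = x k - y := fun k => by
    rw [hP, sub_mulVec, one_mulVec, ← mulVec_mulVec, mulVec_sub Ap, hfeas, hApy, sub_self,
      mulVec_zero, sub_zero]
  have hde : ∀ k, d k ⬝ᵥ (x k - y) = -((S k)ᵀ.mulVec (Ar.mulVec (x k) - br)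
      ⬝ᵥ (S k)ᵀ.mulVec (Ar.mulVec (x k) - br)) := fun k => by
    have hadj : (x k - y) ᵥ* (P * Arᵀ * S k) = (S k)ᵀ.mulVec (Ar.mulVec (x k) - br) := by
      rw [← mulVec_transpose, transpose_mul, transpose_mul, transpose_transpose, hPsymm,
        ← mulVec_mulVec, ← mulVec_mulVec, hPe, hres]
    rw [hd, neg_dotProduct, dotProduct_comm, dotProduct_mulVec, hadj]
  have horth := truncated_gramSchmidt_orthogonal ℓ p d hrec
  have hstep : ∀ k, p k ⬝ᵥ (x (k + 1) - y) = 0 := fun k => by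
    obtain ⟨⟨t, ht⟩, hle⟩ := hmin k
    refine dotProduct_eq_zero_of_forall_le _ _ fun u => ?_
    have hshift : x k + (t + u) • p k - y = x (k + 1) - y + u • p k := by
      rw [ht, add_smul]
      abel
    simpa only [hshift] using hle (t + u)
  have herr : ∀ k i, k + 1 - ℓ ≤ i → i < k → p i ⬝ᵥ (x k - y) = 0 := by
    intro k
    induction k with
    | zero => intro i _ hi; omega
    | succ k ih =>
      intro i hi hik
      rcases Nat.lt_succ_iff_lt_or_eq.1 hik with h | rfl
      · obtain ⟨t, ht⟩ := (hmin k).1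
        rw [ht, add_sub_right_comm, dotProduct_add, dotProduct_smul, ih i (by omega) h,
          horth k i (by omega) h, smul_zero, add_zero]
      · exact hstep i
  have hpe : ∀ k, p k ⬝ᵥ (x k - y) = d k ⬝ᵥ (x k - y) := fun k => by
    rcases Nat.eq_zero_or_pos k with rfl | hk
    · rw [hp0]
    · rw [hrec k hk, sub_dotProduct, sum_dotProduct, Finset.sum_eq_zero, sub_zero]
      intro i hi
      rw [Finset.mem_Ico] at hi
      rw [smul_dotProduct, herr k i hi.1 hi.2, smul_zero]
  refine ⟨hfeas, fun k hk => ⟨fun h0 => ?_, (hpe k).trans (hde k)⟩,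
    fun k _ _ _ μ ν hμ hμν hν => horth ν μ (by omega) hμν⟩
  have hzero := (hpe k).trans (hde k)
  rw [h0, zero_dotProduct, eq_comm, neg_eq_zero] at hzero
  exact hk k le_rfl (dotProduct_self_eq_zero.1 hzero)
end

section
/- Suppose A x = b is consistent. Let ℓ ≥ 1, j_{k,ℓ} := max{k − ℓ + 1, 0}, and let {x^k}_{k≥0} and {p^k}_{k≥0} be generated as follows: x^0 := A_{I_p}† b_{I_p}; p^k is obtained by truncated Gram–Schmidt orthogonalization of d^k := −P A_{I_r}^T S_k S_k^T (A_{I_r} x^k − b_{I_r}) against p^{j_{k,ℓ}}, …, p^{k−1}; and x^{k+1} := x^k + δ_k p^k with δ_k := ‖S_k^T (A_{I_r} x^k − b_{I_r})‖₂²/‖p^k‖₂². Assume S_i^T (A_{I_r} x^i − b_{I_r}) ≠ 0 for all i ≤ k, so that all p^i are nonzero. Then x^{k+1} is the unique minimizer of ‖x − A† b‖₂² over the affine subspace x^{j_{k,ℓ}} + span{p^{j_{k,ℓ}}, p^{j_{k,ℓ}+1}, …, p^k}. -/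
open Matrix

section TruncatedGramSchmidt

variable {ι : Type*} [Fintype ι] {ℓ : ℕ} {p d : ℕ → ι → ℝ}

/-- Truncated Gram–Schmidt makes each vector orthogonal to its preceding window. -/
lemma dotProduct_eq_zero_of_truncated_gramSchmidt
    (hrec : ∀ k, p k = d k -
      ∑ i ∈ Finset.Ico (k + 1 - ℓ) k, ((d k ⬝ᵥ p i) / (p i ⬝ᵥ p i)) • p i)
    (k : ℕ) : ∀ j ∈ Finset.Ico (k + 1 - ℓ) k, p k ⬝ᵥ p j = 0 := by
  induction k using Nat.strong_induction_on with
  | _ k ih =>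
    intro j hj
    have hsum : ∑ i ∈ Finset.Ico (k + 1 - ℓ) k,
        ((d k ⬝ᵥ p i) / (p i ⬝ᵥ p i)) * (p i ⬝ᵥ p j) = d k ⬝ᵥ p j := by
      rw [Finset.sum_eq_single_of_mem j hj]
      · by_cases hp : p j ⬝ᵥ p j = 0
        · simp [dotProduct_self_eq_zero.mp hp]
        · field_simp
      · intro i hi hij
        rw [Finset.mem_Ico] at hi hj
        rcases lt_or_gt_of_ne hij with h | h
        · rw [dotProduct_comm (p i) (p j), ih j hj.2 i (by rw [Finset.mem_Ico]; omega), mul_zero]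
        · rw [ih i hi.2 j (by rw [Finset.mem_Ico]; omega), mul_zero]
    rw [hrec k, sub_dotProduct, sum_dotProduct]
    simp only [smul_dotProduct, smul_eq_mul]
    rw [hsum, sub_self]

/-- Exact line search along truncated Gram–Schmidt directions keeps the error orthogonal to
the window of most recent directions. -/
lemma error_dotProduct_eq_zero {e : ℕ → ι → ℝ} {ρ : ℕ → ℝ}
    (hrec : ∀ k, p k = d k -
      ∑ i ∈ Finset.Ico (k + 1 - ℓ) k, ((d k ⬝ᵥ p i) / (p i ⬝ᵥ p i)) • p i)
    (hde : ∀ k, d k ⬝ᵥ e k = -ρ k)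
    (he : ∀ k, e (k + 1) = e k + (ρ k / (p k ⬝ᵥ p k)) • p k)
    (k : ℕ) : ∀ j ∈ Finset.Icc (k + 1 - ℓ) k, e (k + 1) ⬝ᵥ p j = 0 := by
  have key : ∀ k, (∀ i ∈ Finset.Ico (k + 1 - ℓ) k, e k ⬝ᵥ p i = 0) →
      ∀ j ∈ Finset.Icc (k + 1 - ℓ) k, e (k + 1) ⬝ᵥ p j = 0 := by
    intro k hk j hj
    rw [he, add_dotProduct, smul_dotProduct, smul_eq_mul]
    rw [Finset.mem_Icc] at hj
    rcases hj.2.lt_or_eq with h | rfl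
    · have hj' : j ∈ Finset.Ico (k + 1 - ℓ) k := Finset.mem_Ico.mpr ⟨hj.1, h⟩
      rw [hk j hj', dotProduct_eq_zero_of_truncated_gramSchmidt hrec k j hj', mul_zero, add_zero]
    · have hpe : e j ⬝ᵥ p j = -ρ j := by
        have hsum : ∑ i ∈ Finset.Ico (j + 1 - ℓ) j,
            ((d j ⬝ᵥ p i) / (p i ⬝ᵥ p i)) * (e j ⬝ᵥ p i) = 0 :=
          Finset.sum_eq_zero fun i hi => by rw [hk i hi, mul_zero]
        rw [hrec j, dotProduct_sub, dotProduct_sum]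
        simp only [dotProduct_smul, smul_eq_mul]
        rw [hsum, sub_zero, dotProduct_comm, hde]
      by_cases hp : p j ⬝ᵥ p j = 0
      · simp [dotProduct_self_eq_zero.mp hp]
      · rw [hpe]
        field_simp
        ring
  induction k with
  | zero => exact key 0 (by simp)
  | succ k ih =>
    refine key (k + 1) fun i hi => ih i ?_
    rw [Finset.mem_Ico] at hi
    rw [Finset.mem_Icc]
    omega

end TruncatedGramSchmidt

/-- The Pythagorean identity for the dot product. -/
lemma dotProduct_self_add_of_orthogonal {ι : Type*} [Fintype ι] {e w : ι → ℝ}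
    (h : e ⬝ᵥ w = 0) : (e + w) ⬝ᵥ (e + w) = e ⬝ᵥ e + w ⬝ᵥ w := by
  rw [add_dotProduct, dotProduct_add, dotProduct_add, dotProduct_comm w e, h]
  ring

/-- Telescoping a recursion `x (k + 1) = x k + v k`. -/
lemma eq_add_sum_Icc_of_succ {E : Type*} [AddCommGroup E] {x v : ℕ → E}
    (h : ∀ k, x (k + 1) = x k + v k) {j k : ℕ} (hjk : j ≤ k) :
    x (k + 1) = x j + ∑ i ∈ Finset.Icc j k, v i := by
  induction k, hjk using Nat.le_induction with
  | base => simp [h]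
  | succ k hk ih => rw [h, ih, Finset.sum_Icc_succ_top (by omega), add_assoc]

/-- For the SC-IS-Krylov iteration, `x^{k+1}` is the unique minimizer
of `‖x − A†b‖₂²` over the affine subspace
`x^{j_{k,ℓ}} + span{p^{j_{k,ℓ}}, …, p^k}` (with `j_{k,ℓ} = max (k−ℓ+1) 0`,
written `k + 1 - ℓ` in `ℕ`). -/
theorem stmt18 {m n q : ℕ} (A : Matrix (Fin m) (Fin n) ℝ) (b : Fin m → ℝ) (Ip : Finset (Fin m))
    (ℓ : ℕ) (hℓ : 1 ≤ ℓ)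
    (Ap : Matrix {i // i ∈ Ip} (Fin n) ℝ) (hApdef : Ap = A.submatrix Subtype.val id)
    (Ar : Matrix {i // i ∈ Ipᶜ} (Fin n) ℝ) (hArdef : Ar = A.submatrix Subtype.val id)
    (Ad : Matrix (Fin n) (Fin m) ℝ) (hAd : IsMoorePenrose A Ad)
    (Apd : Matrix (Fin n) {i // i ∈ Ip} ℝ) (hApd : IsMoorePenrose Ap Apd)
    (P : Matrix (Fin n) (Fin n) ℝ) (hP : P = 1 - Apd * Ap)
    (bp : {i // i ∈ Ip} → ℝ) (hbp : bp = fun i => b i.1)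
    (br : {i // i ∈ Ipᶜ} → ℝ) (hbr : br = fun i => b i.1)
    (hcons : ∃ xs : Fin n → ℝ, A.mulVec xs = b)
    (S : ℕ → Matrix {i // i ∈ Ipᶜ} (Fin q) ℝ)
    (x p d : ℕ → Fin n → ℝ) (δ : ℕ → ℝ)
    (hx0 : x 0 = Apd.mulVec bp)
    (hd : ∀ k, d k = -((P * Arᵀ * S k).mulVec ((S k)ᵀ.mulVec (Ar.mulVec (x k) - br))))
    (hp0 : p 0 = d 0)
    (hrec : ∀ k, 1 ≤ k →
      p k = d k - ∑ i ∈ Finset.Ico (k + 1 - ℓ) k, ((d k ⬝ᵥ p i) / (p i ⬝ᵥ p i)) • p i)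
    (hδ : ∀ k, δ k = ((S k)ᵀ.mulVec (Ar.mulVec (x k) - br)
        ⬝ᵥ (S k)ᵀ.mulVec (Ar.mulVec (x k) - br)) / (p k ⬝ᵥ p k))
    (hxsucc : ∀ k, x (k + 1) = x k + δ k • p k)
    (k : ℕ) (hSnz : ∀ i, i ≤ k → (S i)ᵀ.mulVec (Ar.mulVec (x i) - br) ≠ 0) :
    (∃ c : ℕ → ℝ,
        x (k + 1) = x (k + 1 - ℓ) + ∑ i ∈ Finset.Icc (k + 1 - ℓ) k, c i • p i) ∧
      ∀ z : Fin n → ℝ,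
        (∃ c : ℕ → ℝ, z = x (k + 1 - ℓ) + ∑ i ∈ Finset.Icc (k + 1 - ℓ) k, c i • p i) →
        ((x (k + 1) - Ad.mulVec b) ⬝ᵥ (x (k + 1) - Ad.mulVec b)
            ≤ (z - Ad.mulVec b) ⬝ᵥ (z - Ad.mulVec b)) ∧
          (z ≠ x (k + 1) →
            (x (k + 1) - Ad.mulVec b) ⬝ᵥ (x (k + 1) - Ad.mulVec b)
              < (z - Ad.mulVec b) ⬝ᵥ (z - Ad.mulVec b)) := by
  set u := Ad.mulVec b with hu
  have hAu : A.mulVec u = b := by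
    obtain ⟨xs, rfl⟩ := hcons
    rw [hu, mulVec_mulVec, mulVec_mulVec, hAd.1]
  have hApu : Ap.mulVec u = bp := by
    subst hApdef hbp
    ext i
    exact congrFun hAu i.1
  have hAru : Ar.mulVec u = br := by
    subst hArdef hbr
    ext i
    exact congrFun hAu i.1
  have hApP : Ap * P = 0 := by
    rw [hP, Matrix.mul_sub, Matrix.mul_one, ← Matrix.mul_assoc, hApd.1, sub_self]
  have hPt : Pᵀ = P := by rw [hP, transpose_sub, transpose_one, hApd.2.2.2]
  have hPfix : ∀ v, Ap.mulVec v = 0 → P.mulVec v = v := by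
    intro v hv
    rw [hP, sub_mulVec, one_mulVec, ← mulVec_mulVec, hv, mulVec_zero, sub_zero]
  have hrec' : ∀ k, p k = d k -
      ∑ i ∈ Finset.Ico (k + 1 - ℓ) k, ((d k ⬝ᵥ p i) / (p i ⬝ᵥ p i)) • p i := by
    intro k
    rcases Nat.eq_zero_or_pos k with rfl | hk
    · simpa using hp0
    · exact hrec k hk
  have hApd0 : ∀ k, Ap.mulVec (d k) = 0 := by
    intro k
    rw [hd, mulVec_neg, mulVec_mulVec, Matrix.mul_assoc P, ← Matrix.mul_assoc Ap, hApP,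
      Matrix.zero_mul, zero_mulVec, neg_zero]
  have hApp0 : ∀ k, Ap.mulVec (p k) = 0 := by
    intro k
    induction k using Nat.strong_induction_on with
    | _ k ih =>
      rw [hrec' k, mulVec_sub, hApd0, mulVec_sum, zero_sub, neg_eq_zero]
      refine Finset.sum_eq_zero fun i hi => ?_
      rw [mulVec_smul, ih i (Finset.mem_Ico.mp hi).2, smul_zero]
  have hApe : ∀ k, Ap.mulVec (x k - u) = 0 := by
    intro k
    induction k with
    | zero => rw [hx0, mulVec_sub, ← hApu, mulVec_mulVec, mulVec_mulVec, hApd.1, sub_self]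
    | succ k ih =>
      rw [hxsucc, add_sub_right_comm, mulVec_add, ih, mulVec_smul, hApp0, smul_zero, add_zero]
  have hde : ∀ k, d k ⬝ᵥ (x k - u) = -((S k)ᵀ.mulVec (Ar.mulVec (x k) - br)
      ⬝ᵥ (S k)ᵀ.mulVec (Ar.mulVec (x k) - br)) := by
    intro k
    have hadj : (P * Arᵀ * S k)ᵀ.mulVec (x k - u) =
        (S k)ᵀ.mulVec (Ar.mulVec (x k) - br) := by
      rw [transpose_mul, transpose_mul, transpose_transpose, hPt, ← mulVec_mulVec,
        ← mulVec_mulVec, hPfix _ (hApe k), mulVec_sub Ar, hAru]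
    rw [hd, neg_dotProduct, dotProduct_comm, dotProduct_mulVec, ← mulVec_transpose, hadj]
  have hes : ∀ k, x (k + 1) - u = (x k - u) + (((S k)ᵀ.mulVec (Ar.mulVec (x k) - br)
      ⬝ᵥ (S k)ᵀ.mulVec (Ar.mulVec (x k) - br)) / (p k ⬝ᵥ p k)) • p k := by
    intro k
    rw [hxsucc, ← hδ, add_sub_right_comm]
  have horth := error_dotProduct_eq_zero (e := fun k => x k - u) hrec' hde hes k
  have htel : x (k + 1) = x (k + 1 - ℓ) + ∑ i ∈ Finset.Icc (k + 1 - ℓ) k, δ i • p i :=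
    eq_add_sum_Icc_of_succ hxsucc (by omega)
  refine ⟨⟨δ, htel⟩, ?_⟩
  rintro z ⟨c, hz⟩
  have hdiff : z - x (k + 1) = ∑ i ∈ Finset.Icc (k + 1 - ℓ) k, (c i - δ i) • p i := by
    simp only [sub_smul, Finset.sum_sub_distrib]
    rw [hz, htel]
    abel
  have hperp : (x (k + 1) - u) ⬝ᵥ (z - x (k + 1)) = 0 := by
    rw [hdiff, dotProduct_sum]
    refine Finset.sum_eq_zero fun i hi => ?_
    rw [dotProduct_smul, horth i hi, smul_zero]
  have hpyth := dotProduct_self_add_of_orthogonal hperp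
  rw [show x (k + 1) - u + (z - x (k + 1)) = z - u by abel] at hpyth
  have hnonneg : 0 ≤ (z - x (k + 1)) ⬝ᵥ (z - x (k + 1)) :=
    Finset.sum_nonneg fun i _ => mul_self_nonneg _
  rw [hpyth]
  refine ⟨le_add_of_nonneg_right hnonneg, fun hne => lt_add_of_pos_right _ ?_⟩
  exact hnonneg.lt_of_ne' fun h => hne (sub_eq_zero.mp (dotProduct_self_eq_zero.mp h))
end

section
/- Suppose A x = b is consistent. Define b̂_{I_r} := b_{I_r} − A_{I_r} A_{I_p}† b_{I_p}, x^0 := A_{I_p}† b_{I_p}, and r̂_{I_r}^0 := A_{I_r} P x^0 − b̂_{I_r}. Let the sequences {x^k} and {p^k} be generated with ℓ = ∞ and the deterministic sketch S_k = I (identity): d^k := −P A_{I_r}^T (A_{I_r} x^k − b_{I_r}), p^0 := d^0, p^k := d^k − Σ_{i=0}^{k−1} (⟨d^k, p^i⟩/‖p^i‖₂²) p^i, x^{k+1} := x^k + (‖A_{I_r} x^k − b_{I_r}‖₂²/‖p^k‖₂²) p^k, and assume A_{I_r} x^i ≠ b_{I_r} for all i ≤ k (so all p^i are nonzero). Then the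 three affine subspaces x^0 + span{p^0, p^1, …, p^k}, x^0 + K_{k+1}(P A_{I_r}^T A_{I_r} P, P A_{I_r}^T r̂_{I_r}^0), and x^0 + K_{k+1}(A_{I_p}^T A_{I_p} + P A_{I_r}^T A_{I_r} P, P A_{I_r}^T r̂_{I_r}^0) coincide, where K_j(B, v) := span{v, B v, B² v, …, B^{j−1} v} denotes the Krylov subspace of order j. -/
open Matrix

/-- The Krylov subspace `K_j(B, v) = span{v, B v, …, B^{j−1} v}`. -/
def krylov {n : ℕ} (j : ℕ) (B : Matrix (Fin n) (Fin n) ℝ) (v : Fin n → ℝ) :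
    Submodule ℝ (Fin n → ℝ) :=
  Submodule.span ℝ {w : Fin n → ℝ | ∃ i < j, w = (B ^ i).mulVec v}

lemma pow_mulVec_mem_krylov {n : ℕ} (B : Matrix (Fin n) (Fin n) ℝ) (v : Fin n → ℝ) {i j : ℕ}
    (h : i < j) : (B ^ i).mulVec v ∈ krylov j B v :=
  Submodule.subset_span ⟨i, h, rfl⟩

lemma krylov_mono {n : ℕ} (B : Matrix (Fin n) (Fin n) ℝ) (v : Fin n → ℝ) {i j : ℕ}
    (h : i ≤ j) : krylov i B v ≤ krylov j B v :=
  Submodule.span_mono fun _ ⟨l, hl, hw⟩ => ⟨l, hl.trans_le h, hw⟩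

lemma mulVec_mem_krylov_succ {n : ℕ} {B : Matrix (Fin n) (Fin n) ℝ} {v u : Fin n → ℝ} {j : ℕ}
    (hu : u ∈ krylov j B v) : B.mulVec u ∈ krylov (j + 1) B v := by
  have hle : krylov j B v ≤ (krylov (j + 1) B v).comap B.mulVecLin := by
    refine Submodule.span_le.2 ?_
    rintro _ ⟨i, hi, rfl⟩
    simpa [pow_succ'] using pow_mulVec_mem_krylov B v (Nat.succ_lt_succ hi)
  exact hle hu

lemma krylov_neg {n : ℕ} (j : ℕ) (B : Matrix (Fin n) (Fin n) ℝ) (v : Fin n → ℝ) :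
    krylov j B (-v) = krylov j B v := by
  have hle (v : Fin n → ℝ) : krylov j B (-v) ≤ krylov j B v := by
    refine Submodule.span_le.2 ?_
    rintro _ ⟨i, hi, rfl⟩
    simpa [mulVec_neg] using pow_mulVec_mem_krylov B v hi
  exact (hle v).antisymm (by simpa using hle (-v))

/-- Adding a matrix that annihilates the range of `B` and the starting vector does not change
the Krylov subspace. -/
lemma krylov_add_left {n : ℕ} (j : ℕ) {B C : Matrix (Fin n) (Fin n) ℝ} {v : Fin n → ℝ}
    (hCB : C * B = 0) (hCv : C.mulVec v = 0) : krylov j (C + B) v = krylov j B v := by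
  have hC (i : ℕ) : C.mulVec ((B ^ i).mulVec v) = 0 := by
    cases i with
    | zero => simpa using hCv
    | succ i => rw [pow_succ', mulVec_mulVec, ← mul_assoc, hCB, zero_mul, zero_mulVec]
  have hpow (i : ℕ) : ((C + B) ^ i).mulVec v = (B ^ i).mulVec v := by
    induction i with
    | zero => simp
    | succ i ih =>
      rw [pow_succ', ← mulVec_mulVec, ih, add_mulVec, hC, zero_add, mulVec_mulVec, ← pow_succ']
  simp only [krylov, hpow]

/-- Vectors produced by the Gram–Schmidt recursion are pairwise orthogonal. -/
lemma dotProduct_eq_zero_of_gramSchmidt {n : ℕ} {p d : ℕ → Fin n → ℝ}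
    (hrec : ∀ k, p k = d k - ∑ i ∈ Finset.range k, ((d k ⬝ᵥ p i) / (p i ⬝ᵥ p i)) • p i)
    {i j : ℕ} (hij : i < j) : p j ⬝ᵥ p i = 0 := by
  induction j using Nat.strong_induction_on generalizing i with
  | _ j ih =>
    have hsum : ∑ l ∈ Finset.range j, ((d j ⬝ᵥ p l) / (p l ⬝ᵥ p l)) * (p l ⬝ᵥ p i)
        = ((d j ⬝ᵥ p i) / (p i ⬝ᵥ p i)) * (p i ⬝ᵥ p i) := by
      refine Finset.sum_eq_single_of_mem i (Finset.mem_range.2 hij) fun l hl hli => ?_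
      rcases lt_or_gt_of_ne hli with h | h
      · rw [dotProduct_comm (p l) (p i), ih i hij h, mul_zero]
      · rw [ih l (Finset.mem_range.1 hl) h, mul_zero]
    rw [hrec j, sub_dotProduct, sum_dotProduct]
    simp only [smul_dotProduct, smul_eq_mul]
    rw [hsum]
    by_cases hp : p i = 0
    · simp [hp]
    · rw [div_mul_cancel₀ _ (by simpa using hp), sub_self]

/-- In the orthogonal-error recursion, the search direction `p j` has inner product `-ρ j` with
the error `e j`, as long as the residuals `ρ` do not vanish. -/
lemma dotProduct_error {n : ℕ} {p d e : ℕ → Fin n → ℝ} {ρ : ℕ → ℝ} {k : ℕ}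
    (hrec : ∀ k, p k = d k - ∑ i ∈ Finset.range k, ((d k ⬝ᵥ p i) / (p i ⬝ᵥ p i)) • p i)
    (he : ∀ j, e (j + 1) = e j + (ρ j / (p j ⬝ᵥ p j)) • p j)
    (hde : ∀ j, d j ⬝ᵥ e j = -ρ j) (hρ : ∀ j ≤ k, ρ j ≠ 0) {j : ℕ} (hj : j ≤ k) :
    p j ⬝ᵥ e j = -ρ j := by
  have key (j : ℕ) (h : ∀ i < j, p i ⬝ᵥ e j = 0) : p j ⬝ᵥ e j = -ρ j := by
    rw [hrec j, sub_dotProduct, sum_dotProduct, hde, Finset.sum_eq_zero, sub_zero]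
    intro i hi
    rw [smul_dotProduct, h i (Finset.mem_range.1 hi), smul_zero]
  refine key j ?_
  induction j with
  | zero => simp
  | succ j ih =>
    have ih' := ih (by omega)
    have hpe := key j ih'
    intro i hi
    rw [he, dotProduct_add, dotProduct_smul, smul_eq_mul]
    rcases Nat.lt_succ_iff_lt_or_eq.1 hi with h | rfl
    · rw [ih' i h, dotProduct_comm (p i) (p j), dotProduct_eq_zero_of_gramSchmidt hrec h]
      simp
    · have hp : p i ⬝ᵥ p i ≠ 0 := by
        intro h0
        rw [dotProduct_self_eq_zero.1 h0, zero_dotProduct] at hpe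
        exact hρ i (by omega) (by linarith)
      rw [hpe, div_mul_cancel₀ _ hp, neg_add_cancel]

/-- The search directions of a gradient recursion whose directions are combined with the
preceding ones span the Krylov subspaces. -/
lemma span_directions_eq_krylov {n : ℕ} {M : Matrix (Fin n) (Fin n) ℝ} {p d : ℕ → Fin n → ℝ}
    {α : ℕ → ℝ} {c : ℕ → ℕ → ℝ} {k : ℕ}
    (hrec : ∀ j, p j = d j - ∑ i ∈ Finset.range j, c j i • p i)
    (hd : ∀ j, d (j + 1) = d j - α j • M.mulVec (p j)) (hα : ∀ j < k, α j ≠ 0) :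
    Submodule.span ℝ {w | ∃ i ≤ k, w = p i} = krylov (k + 1) M (d 0) := by
  have hp0 : p 0 = d 0 := by simp [hrec 0]
  apply le_antisymm
  · have h (j : ℕ) : d j ∈ krylov (j + 1) M (d 0) ∧ ∀ i ≤ j, p i ∈ krylov (j + 1) M (d 0) := by
      induction j with
      | zero =>
        have h0 : d 0 ∈ krylov 1 M (d 0) := by
          simpa using pow_mulVec_mem_krylov M (d 0) zero_lt_one
        refine ⟨h0, fun i hi => ?_⟩
        rwa [Nat.le_zero.1 hi, hp0]
      | succ j ih =>
        have hle := krylov_mono M (d 0) (Nat.le_succ (j + 1))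
        have hdj : d (j + 1) ∈ krylov (j + 1 + 1) M (d 0) := by
          rw [hd]
          exact sub_mem (hle ih.1)
            (Submodule.smul_mem _ _ (mulVec_mem_krylov_succ (ih.2 j le_rfl)))
        refine ⟨hdj, fun i hi => ?_⟩
        rcases Nat.le_succ_iff.1 hi with h | rfl
        · exact hle (ih.2 i h)
        · rw [hrec]
          exact sub_mem hdj (Submodule.sum_mem _ fun l hl => Submodule.smul_mem _ _
            (hle (ih.2 l (Nat.lt_succ_iff.1 (Finset.mem_range.1 hl)))))
    refine Submodule.span_le.2 ?_
    rintro _ ⟨i, hi, rfl⟩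
    exact (h k).2 i hi
  · set S : ℕ → Submodule ℝ (Fin n → ℝ) := fun j => Submodule.span ℝ {w | ∃ i ≤ j, w = p i}
    have hpS {i j : ℕ} (h : i ≤ j) : p i ∈ S j := Submodule.subset_span ⟨i, h, rfl⟩
    have hdS {i j : ℕ} (h : i ≤ j) : d i ∈ S j := by
      rw [← sub_add_cancel (d i) (∑ l ∈ Finset.range i, c i l • p l), ← hrec]
      exact add_mem (hpS h) (Submodule.sum_mem _ fun l hl =>
        Submodule.smul_mem _ _ (hpS ((Finset.mem_range.1 hl).le.trans h)))
    have hM {j : ℕ} (hj : j < k) : S j ≤ (S (j + 1)).comap M.mulVecLin := by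
      refine Submodule.span_le.2 ?_
      rintro _ ⟨i, hi, rfl⟩
      have hMp : M.mulVec (p i) = (α i)⁻¹ • (d i - d (i + 1)) := by
        rw [hd, sub_sub_cancel, inv_smul_smul₀ (hα i (by omega))]
      change M.mulVec (p i) ∈ S (j + 1)
      rw [hMp]
      exact Submodule.smul_mem _ _ (sub_mem (hdS (by omega)) (hdS (by omega)))
    have hpow (j : ℕ) (hj : j ≤ k) : (M ^ j).mulVec (d 0) ∈ S j := by
      induction j with
      | zero => simpa using hdS le_rfl
      | succ j ih =>
        rw [pow_succ', ← mulVec_mulVec]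
        exact hM hj (ih (by omega))
    refine Submodule.span_le.2 ?_
    rintro _ ⟨j, hj, rfl⟩
    have hjk := Nat.lt_succ_iff.1 hj
    have hle : S j ≤ S k := Submodule.span_mono fun _ ⟨i, hi, hw⟩ => ⟨i, hi.trans hjk, hw⟩
    exact hle (hpow j hjk)

/-- With `ℓ = ∞` and the deterministic sketch `S_k = I`, the affine
subspaces `x⁰ + span{p⁰,…,p^k}`, `x⁰ + K_{k+1}(P A_{I_r}ᵀ A_{I_r} P, P A_{I_r}ᵀ r̂⁰)`
and `x⁰ + K_{k+1}(A_{I_p}ᵀ A_{I_p} + P A_{I_r}ᵀ A_{I_r} P, P A_{I_r}ᵀ r̂⁰)` coincide. -/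
theorem stmt19 {m n : ℕ} (A : Matrix (Fin m) (Fin n) ℝ) (b : Fin m → ℝ) (Ip : Finset (Fin m))
    (Ap : Matrix {i // i ∈ Ip} (Fin n) ℝ) (hApdef : Ap = A.submatrix Subtype.val id)
    (Ar : Matrix {i // i ∈ Ipᶜ} (Fin n) ℝ) (hArdef : Ar = A.submatrix Subtype.val id)
    (Apd : Matrix (Fin n) {i // i ∈ Ip} ℝ) (hApd : IsMoorePenrose Ap Apd)
    (P : Matrix (Fin n) (Fin n) ℝ) (hP : P = 1 - Apd * Ap)
    (bp : {i // i ∈ Ip} → ℝ) (hbp : bp = fun i => b i.1)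
    (br : {i // i ∈ Ipᶜ} → ℝ) (hbr : br = fun i => b i.1)
    (bhat : {i // i ∈ Ipᶜ} → ℝ) (hbhat : bhat = br - Ar.mulVec (Apd.mulVec bp))
    (hcons : ∃ xs : Fin n → ℝ, A.mulVec xs = b)
    (x p d : ℕ → Fin n → ℝ)
    (hx0 : x 0 = Apd.mulVec bp)
    (rhat0 : {i // i ∈ Ipᶜ} → ℝ) (hrhat0 : rhat0 = (Ar * P).mulVec (x 0) - bhat)
    (hd : ∀ k, d k = -((P * Arᵀ).mulVec (Ar.mulVec (x k) - br)))
    (hp0 : p 0 = d 0)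
    (hrec : ∀ k, 1 ≤ k →
      p k = d k - ∑ i ∈ Finset.range k, ((d k ⬝ᵥ p i) / (p i ⬝ᵥ p i)) • p i)
    (hxsucc : ∀ k, x (k + 1) = x k
      + (((Ar.mulVec (x k) - br) ⬝ᵥ (Ar.mulVec (x k) - br)) / (p k ⬝ᵥ p k)) • p k)
    (k : ℕ) (hne : ∀ i, i ≤ k → Ar.mulVec (x i) ≠ br) :
    (fun w => x 0 + w) '' (Submodule.span ℝ {w : Fin n → ℝ | ∃ i ≤ k, w = p i} : Set (Fin n → ℝ))
        = (fun w => x 0 + w) ''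
            (krylov (k + 1) (P * Arᵀ * Ar * P) ((P * Arᵀ).mulVec rhat0) : Set (Fin n → ℝ)) ∧
      (fun w => x 0 + w) ''
          (krylov (k + 1) (P * Arᵀ * Ar * P) ((P * Arᵀ).mulVec rhat0) : Set (Fin n → ℝ))
        = (fun w => x 0 + w) ''
            (krylov (k + 1) (Apᵀ * Ap + P * Arᵀ * Ar * P)
              ((P * Arᵀ).mulVec rhat0) : Set (Fin n → ℝ)) := by
  obtain ⟨hPen, -, -, hsymm⟩ := hApd
  obtain ⟨xs, hxs⟩ := hcons
  have hbp' : Ap.mulVec xs = bp := by subst hApdef hbp hxs; rfl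
  have hbr' : Ar.mulVec xs = br := by subst hArdef hbr hxs; rfl
  have hApP : Ap * P = 0 := by rw [hP, Matrix.mul_sub, Matrix.mul_one, ← Matrix.mul_assoc, hPen, sub_self]
  have hPP : P * P = P := by
    nth_rewrite 1 [hP]
    rw [sub_mul, one_mul, Matrix.mul_assoc, hApP, Matrix.mul_zero, sub_zero]
  have hPT : Pᵀ = P := by rw [hP, transpose_sub, transpose_one, hsymm]
  have hrec' : ∀ j, p j = d j - ∑ i ∈ Finset.range j, ((d j ⬝ᵥ p i) / (p i ⬝ᵥ p i)) • p i := by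
    intro j
    rcases Nat.eq_zero_or_pos j with rfl | hj
    · simpa using hp0
    · exact hrec j hj
  have hPd (j : ℕ) : P.mulVec (d j) = d j := by
    rw [hd, mulVec_neg, mulVec_mulVec, ← Matrix.mul_assoc, hPP]
  have hPp (j : ℕ) : P.mulVec (p j) = p j := by
    induction j using Nat.strong_induction_on with
    | _ j ih =>
      rw [hrec' j, mulVec_sub, hPd, mulVec_sum]
      congr 1
      exact Finset.sum_congr rfl fun i hi => by rw [mulVec_smul, ih i (Finset.mem_range.1 hi)]
  have hPe (j : ℕ) : P.mulVec (x j - xs) = x j - xs := by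
    induction j with
    | zero =>
      have h0 : x 0 - xs = P.mulVec (-xs) := by
        rw [hx0, ← hbp', hP, sub_mulVec, one_mulVec, mulVec_neg, ← mulVec_mulVec]
        abel
      rw [h0, mulVec_mulVec, hPP]
    | succ j ih => rw [hxsucc, add_sub_right_comm, mulVec_add, ih, mulVec_smul, hPp]
  have hres (j : ℕ) : Ar.mulVec (x j) - br = Ar.mulVec (x j - xs) := by rw [mulVec_sub, hbr']
  have hde (j : ℕ) : d j ⬝ᵥ (x j - xs)
      = -((Ar.mulVec (x j) - br) ⬝ᵥ (Ar.mulVec (x j) - br)) := by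
    rw [hd, neg_dotProduct, ← mulVec_mulVec, dotProduct_comm, dotProduct_mulVec, ← mulVec_transpose,
      hPT, hPe, dotProduct_mulVec, vecMul_transpose, ← hres]
  have hρ : ∀ j ≤ k, (Ar.mulVec (x j) - br) ⬝ᵥ (Ar.mulVec (x j) - br) ≠ 0 := fun j hj h =>
    hne j hj (sub_eq_zero.1 (dotProduct_self_eq_zero.1 h))
  have hα : ∀ j < k,
      ((Ar.mulVec (x j) - br) ⬝ᵥ (Ar.mulVec (x j) - br)) / (p j ⬝ᵥ p j) ≠ 0 := by
    intro j hj
    refine div_ne_zero (hρ j hj.le) fun h => hρ j hj.le ?_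
    have hpe := dotProduct_error (e := fun j => x j - xs) hrec'
      (fun j => by rw [hxsucc, add_sub_right_comm]) hde hρ hj.le
    rw [dotProduct_self_eq_zero.1 h, zero_dotProduct] at hpe
    exact neg_eq_zero.1 hpe.symm
  have hdsucc (j : ℕ) : d (j + 1) = d j
      - (((Ar.mulVec (x j) - br) ⬝ᵥ (Ar.mulVec (x j) - br)) / (p j ⬝ᵥ p j))
        • (P * Arᵀ * Ar * P).mulVec (p j) := by
    rw [hd (j + 1), hd j, hxsucc, mulVec_add, mulVec_smul, add_sub_right_comm, mulVec_add,
      mulVec_smul, ← mulVec_mulVec (p j) (P * Arᵀ * Ar), hPp, ← mulVec_mulVec (p j) (P * Arᵀ),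
      neg_add, ← sub_eq_add_neg]
  have hPx0 : P.mulVec (x 0) = x 0 - Apd.mulVec bp := by
    rw [hx0, ← hbp', hP, sub_mulVec, one_mulVec, ← mulVec_mulVec _ Apd, mulVec_mulVec _ Ap,
      mulVec_mulVec _ (Ap * Apd), hPen]
  have hrhat : rhat0 = Ar.mulVec (x 0) - br := by
    rw [hrhat0, hbhat, ← mulVec_mulVec, hPx0, ← hx0, sub_self, mulVec_zero]
    abel
  have hv : (P * Arᵀ).mulVec rhat0 = -d 0 := by rw [hd, neg_neg, hrhat]
  constructor
  · rw [span_directions_eq_krylov hrec' hdsucc hα, hv, krylov_neg]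
  · rw [krylov_add_left]
    · simp only [Matrix.mul_assoc]
      rw [← Matrix.mul_assoc Ap P, hApP, Matrix.zero_mul, Matrix.mul_zero]
    · rw [mulVec_mulVec, Matrix.mul_assoc, ← Matrix.mul_assoc Ap P, hApP, Matrix.zero_mul,
        Matrix.mul_zero, zero_mulVec]
end
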